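/- arXiv:2603.27708 — 5 statements merged into one kernel-verified Lean document; each statement's English description precedes it below -/
import Mathlib

section
/- Lyapunov characterization of the incremental L2-plus gain: Let n, m, p be positive naturals, f : ℝ^n → ℝ^n, B ∈ ℝ^{n×m}, C ∈ ℝ^{p×n}, D ∈ ℝ^{p×m}. Suppose V : ℝ^n × ℝ^n × ℝ → ℝ is continuously differentiable and there exist a constant γ⁺ > 0 and class-K∞ functions α̲, ᾱ such that (i) α̲(‖x₁ − x₂‖) ≤ V(x₁, x₂, t) ≤ ᾱ(‖x₁ − x₂‖) for all x₁, x₂ ∈ ℝ^n and t ∈ ℝ, and (ii) for all t ∈ ℝ, x₁, x₂ ∈ ℝ^n, u₁, u₂ ∈ ℝ^m, the directional derivative of V at (x₁, x₂, t) in the direction (f(x₁) + B u₁, f(x₂) + B u₂, 1) is at most γ⁺‖u₁ − u₂‖² − ‖(C x₁ + D u₁) − (C x₂ + D u₂)‖². Then for every t₀ ≤ τ, all continuous inputs u₁, u₂ : ℝ → ℝ^m and all differentiable trajectories x₁, x₂ : ℝ → ℝ^n satisfying xᵢ'(t) = f(xᵢ(t)) + B uᵢ(t) for all t, one has ∫_{t₀}^{τ}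 ‖(C x₁(t) + D u₁(t)) − (C x₂(t) + D u₂(t))‖² dt ≤ γ⁺ ∫_{t₀}^{τ} ‖u₁(t) − u₂(t)‖² dt + ᾱ(‖x₁(t₀) − x₂(t₀)‖). -/
open MeasureTheory intervalIntegral

noncomputable section

/-- Vectors in Euclidean space. -/
abbrev EucSp (n : ℕ) := EuclideanSpace ℝ (Fin n)

/-- Matrix–vector product seen as a map between Euclidean spaces. -/
noncomputable def mvec {p n : ℕ} (M : Matrix (Fin p) (Fin n) ℝ) (v : EucSp n) : EucSp p :=
  (EuclideanSpace.equiv (Fin p) ℝ).symm (M.mulVec ((EuclideanSpace.equiv (Fin n) ℝ) v))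

/-- A function `α : ℝ → ℝ` (viewed on `[0, ∞)`) is of class `K∞`:
continuous, strictly increasing, unbounded, with `α 0 = 0`. -/
structure IsClassKInfty (α : ℝ → ℝ) : Prop where
  continuous : ContinuousOn α (Set.Ici (0 : ℝ))
  strictMono : StrictMonoOn α (Set.Ici (0 : ℝ))
  map_zero : α 0 = 0
  unbounded : ∀ M : ℝ, ∃ r : ℝ, 0 ≤ r ∧ M < α r

theorem lyapunov_incremental_L2_plus
    {n m p : ℕ} (hn : 0 < n) (hm : 0 < m) (hp : 0 < p)
    (f : EucSp n → EucSp n)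
    (B : Matrix (Fin n) (Fin m) ℝ) (C : Matrix (Fin p) (Fin n) ℝ)
    (D : Matrix (Fin p) (Fin m) ℝ)
    (V : EucSp n × EucSp n × ℝ → ℝ) (hV : ContDiff ℝ 1 V)
    (γplus : ℝ) (hγ : 0 < γplus)
    (αlo αhi : ℝ → ℝ) (hαlo : IsClassKInfty αlo) (hαhi : IsClassKInfty αhi)
    (hsandwich : ∀ (x₁ x₂ : EucSp n) (t : ℝ),
      αlo ‖x₁ - x₂‖ ≤ V (x₁, x₂, t) ∧ V (x₁, x₂, t) ≤ αhi ‖x₁ - x₂‖)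
    (hdV : ∀ (t : ℝ) (x₁ x₂ : EucSp n) (u₁ u₂ : EucSp m),
      fderiv ℝ V (x₁, x₂, t) (f x₁ + mvec B u₁, f x₂ + mvec B u₂, (1 : ℝ)) ≤
        γplus * ‖u₁ - u₂‖ ^ 2 -
          ‖(mvec C x₁ + mvec D u₁) - (mvec C x₂ + mvec D u₂)‖ ^ 2) :
    ∀ (t₀ τ : ℝ), t₀ ≤ τ →
    ∀ (u₁ u₂ : ℝ → EucSp m), Continuous u₁ → Continuous u₂ →
    ∀ (x₁ x₂ : ℝ → EucSp n),
      (∀ t, HasDerivAt x₁ (f (x₁ t) + mvec B (u₁ t)) t) →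
      (∀ t, HasDerivAt x₂ (f (x₂ t) + mvec B (u₂ t)) t) →
      (∫ t in t₀..τ,
          ‖(mvec C (x₁ t) + mvec D (u₁ t)) - (mvec C (x₂ t) + mvec D (u₂ t))‖ ^ 2) ≤
        γplus * (∫ t in t₀..τ, ‖u₁ t - u₂ t‖ ^ 2) + αhi ‖x₁ t₀ - x₂ t₀‖ := by
  intro t₀ τ hτ u₁ u₂ hu₁ hu₂ x₁ x₂ hx₁ hx₂
  have hmv : ∀ {a b : ℕ} (M : Matrix (Fin a) (Fin b) ℝ), Continuous (mvec M) := by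
    intro a b M
    unfold mvec
    exact (EuclideanSpace.equiv (Fin a) ℝ).symm.continuous.comp
      (Continuous.matrix_mulVec continuous_const (EuclideanSpace.equiv (Fin b) ℝ).continuous)
  have cx₁ : Continuous x₁ := continuous_iff_continuousAt.2 fun t => (hx₁ t).continuousAt
  have cx₂ : Continuous x₂ := continuous_iff_continuousAt.2 fun t => (hx₂ t).continuousAt
  have cy : Continuous fun t =>
      ‖(mvec C (x₁ t) + mvec D (u₁ t)) - (mvec C (x₂ t) + mvec D (u₂ t))‖ ^ 2 :=
    (((((hmv C).comp cx₁).add ((hmv D).comp hu₁)).sub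
      (((hmv C).comp cx₂).add ((hmv D).comp hu₂))).norm).pow 2
  have cu : Continuous fun t => γplus * ‖u₁ t - u₂ t‖ ^ 2 :=
    continuous_const.mul ((hu₁.sub hu₂).norm.pow 2)
  have cg := cu.sub cy
  have hW : ∀ t, HasDerivAt (fun s => V (x₁ s, x₂ s, s) -
      ∫ r in t₀..s, (γplus * ‖u₁ r - u₂ r‖ ^ 2 -
        ‖(mvec C (x₁ r) + mvec D (u₁ r)) - (mvec C (x₂ r) + mvec D (u₂ r))‖ ^ 2))
      (fderiv ℝ V (x₁ t, x₂ t, t)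
        (f (x₁ t) + mvec B (u₁ t), f (x₂ t) + mvec B (u₂ t), (1 : ℝ)) -
      (γplus * ‖u₁ t - u₂ t‖ ^ 2 -
        ‖(mvec C (x₁ t) + mvec D (u₁ t)) - (mvec C (x₂ t) + mvec D (u₂ t))‖ ^ 2)) t := by
    intro t
    have h1 : HasFDerivAt V (fderiv ℝ V (x₁ t, x₂ t, t)) (x₁ t, x₂ t, t) :=
      (hV.differentiable (by norm_num) _).hasFDerivAt
    have h2 := (hx₁ t).prodMk ((hx₂ t).prodMk (hasDerivAt_id t))
    have h3 := HasFDerivAt.comp_hasDerivAt (f := fun s => (x₁ s, x₂ s, s)) t h1 h2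
    exact h3.sub (cg.integral_hasStrictDerivAt t₀ t).hasDerivAt
  have hanti := antitone_of_hasDerivAt_nonpos hW
    (fun t => sub_nonpos.2 (hdV t (x₁ t) (x₂ t) (u₁ t) (u₂ t)))
  have key := hanti hτ
  simp only [intervalIntegral.integral_same, sub_zero] at key
  rw [intervalIntegral.integral_sub (cu.intervalIntegrable _ _) (cy.intervalIntegrable _ _),
    intervalIntegral.integral_const_mul] at key
  have hlo : 0 ≤ αlo ‖x₁ τ - x₂ τ‖ := by
    rw [← hαlo.map_zero]
    exact hαlo.strictMono.monotoneOn (Set.mem_Ici.2 le_rfl) (Set.mem_Ici.2 (norm_nonneg _))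
      (norm_nonneg _)
  have h4 := (hsandwich (x₁ τ) (x₂ τ) τ).1
  have h5 := (hsandwich (x₁ t₀) (x₂ t₀) t₀).2
  linarith
end
end

section
/- Lyapunov characterization of the incremental L2-minus gain: Let n, m, p be positive naturals, f : ℝ^n → ℝ^n, B ∈ ℝ^{n×m}, C ∈ ℝ^{p×n}, D ∈ ℝ^{p×m}. Suppose V : ℝ^n × ℝ^n × ℝ → ℝ is continuously differentiable and there exist a constant γ⁻ > 0 and class-K∞ functions α̲, ᾱ such that (i) α̲(‖x₁ − x₂‖) ≤ V(x₁, x₂, t) ≤ ᾱ(‖x₁ − x₂‖) for all x₁, x₂ ∈ ℝ^n and t ∈ ℝ, and (ii) for all t ∈ ℝ, x₁, x₂ ∈ ℝ^n, u₁, u₂ ∈ ℝ^m, the directional derivative of V at (x₁, x₂, t) in the direction (f(x₁) + B u₁, f(x₂) + B u₂, 1) is at most −γ⁻‖u₁ − u₂‖² + ‖(C x₁ + D u₁) − (C x₂ + D u₂)‖². Then for every t₀ ≤ τ, all continuous inputs u₁, u₂ : ℝ → ℝ^m and all differentiable trajectories x₁, x₂ : ℝ → ℝ^n satisfying xᵢ'(t)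 = f(xᵢ(t)) + B uᵢ(t) for all t, one has ∫_{t₀}^{τ} ‖(C x₁(t) + D u₁(t)) − (C x₂(t) + D u₂(t))‖² dt ≥ γ⁻ ∫_{t₀}^{τ} ‖u₁(t) − u₂(t)‖² dt − ᾱ(‖x₁(t₀) − x₂(t₀)‖). -/
open MeasureTheory intervalIntegral

noncomputable section

lemma mvec_cont_aux {p n : ℕ} (M : Matrix (Fin p) (Fin n) ℝ) : Continuous (mvec M) := by
  unfold mvec
  exact (EuclideanSpace.equiv (Fin p) ℝ).symm.continuous.comp
    (Continuous.matrix_mulVec continuous_const (EuclideanSpace.equiv (Fin n) ℝ).continuous)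

theorem lyapunov_incremental_L2_minus
    {n m p : ℕ} (hn : 0 < n) (hm : 0 < m) (hp : 0 < p)
    (f : EucSp n → EucSp n)
    (B : Matrix (Fin n) (Fin m) ℝ) (C : Matrix (Fin p) (Fin n) ℝ)
    (D : Matrix (Fin p) (Fin m) ℝ)
    (V : EucSp n × EucSp n × ℝ → ℝ) (hV : ContDiff ℝ 1 V)
    (γminus : ℝ) (hγ : 0 < γminus)
    (αlo αhi : ℝ → ℝ) (hαlo : IsClassKInfty αlo) (hαhi : IsClassKInfty αhi)
    (hsandwich : ∀ (x₁ x₂ : EucSp n) (t : ℝ),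
      αlo ‖x₁ - x₂‖ ≤ V (x₁, x₂, t) ∧ V (x₁, x₂, t) ≤ αhi ‖x₁ - x₂‖)
    (hdV : ∀ (t : ℝ) (x₁ x₂ : EucSp n) (u₁ u₂ : EucSp m),
      fderiv ℝ V (x₁, x₂, t) (f x₁ + mvec B u₁, f x₂ + mvec B u₂, (1 : ℝ)) ≤
        -γminus * ‖u₁ - u₂‖ ^ 2 +
          ‖(mvec C x₁ + mvec D u₁) - (mvec C x₂ + mvec D u₂)‖ ^ 2) :
    ∀ (t₀ τ : ℝ), t₀ ≤ τ →
    ∀ (u₁ u₂ : ℝ → EucSp m), Continuous u₁ → Continuous u₂ →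
    ∀ (x₁ x₂ : ℝ → EucSp n),
      (∀ t, HasDerivAt x₁ (f (x₁ t) + mvec B (u₁ t)) t) →
      (∀ t, HasDerivAt x₂ (f (x₂ t) + mvec B (u₂ t)) t) →
      (∫ t in t₀..τ,
          ‖(mvec C (x₁ t) + mvec D (u₁ t)) - (mvec C (x₂ t) + mvec D (u₂ t))‖ ^ 2) ≥
        γminus * (∫ t in t₀..τ, ‖u₁ t - u₂ t‖ ^ 2) - αhi ‖x₁ t₀ - x₂ t₀‖ := by
  intro t₀ τ hτ u₁ u₂ hu₁ hu₂ x₁ x₂ hx₁ hx₂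
  have cx₁ : Continuous x₁ := continuous_iff_continuousAt.2 fun t => (hx₁ t).continuousAt
  have cx₂ : Continuous x₂ := continuous_iff_continuousAt.2 fun t => (hx₂ t).continuousAt
  have hW : ∀ t, HasDerivAt (fun t => V (x₁ t, x₂ t, t))
      (fderiv ℝ V (x₁ t, x₂ t, t)
        (f (x₁ t) + mvec B (u₁ t), f (x₂ t) + mvec B (u₂ t), (1 : ℝ))) t := by
    intro t
    have h1 : HasFDerivAt V (fderiv ℝ V (x₁ t, x₂ t, t)) (x₁ t, x₂ t, t) :=
      ((hV.differentiable (by norm_num)) _).hasFDerivAt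
    exact h1.comp_hasDerivAt t ((hx₁ t).prodMk ((hx₂ t).prodMk (hasDerivAt_id t)))
  have c1 : Continuous fun t => ‖u₁ t - u₂ t‖ ^ 2 := (hu₁.sub hu₂).norm.pow 2
  have c2 : Continuous fun t =>
      ‖(mvec C (x₁ t) + mvec D (u₁ t)) - (mvec C (x₂ t) + mvec D (u₂ t))‖ ^ 2 :=
    (((((mvec_cont_aux C).comp cx₁).add ((mvec_cont_aux D).comp hu₁)).sub
      (((mvec_cont_aux C).comp cx₂).add ((mvec_cont_aux D).comp hu₂))).norm).pow 2
  have c3 : Continuous fun t => -γminus * ‖u₁ t - u₂ t‖ ^ 2 := continuous_const.mul c1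
  have c4 : Continuous fun t => -γminus * ‖u₁ t - u₂ t‖ ^ 2 +
      ‖(mvec C (x₁ t) + mvec D (u₁ t)) - (mvec C (x₂ t) + mvec D (u₂ t))‖ ^ 2 := c3.add c2
  have key := intervalIntegral.sub_le_integral_of_hasDeriv_right_of_le hτ
    (fun t _ => (hW t).continuousAt.continuousWithinAt)
    (fun t _ => (hW t).hasDerivWithinAt)
    (c4.continuousOn.integrableOn_compact isCompact_Icc)
    (fun t _ => hdV t (x₁ t) (x₂ t) (u₁ t) (u₂ t))
  rw [intervalIntegral.integral_add (c3.intervalIntegrable _ _)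
    (c2.intervalIntegrable _ _), intervalIntegral.integral_const_mul] at key
  have h0 := (hsandwich (x₁ t₀) (x₂ t₀) t₀).2
  have h1 := (hsandwich (x₁ τ) (x₂ τ) τ).1
  have h2 : 0 ≤ αlo ‖x₁ τ - x₂ τ‖ := by
    rw [← hαlo.map_zero]
    exact hαlo.strictMono.monotoneOn (Set.mem_Ici.2 le_rfl)
      (Set.mem_Ici.2 (norm_nonneg _)) (norm_nonneg _)
  linarith
end
end

section
/- Failure of the innovation-based detector under a replay attack (core estimate of Proposition 3): Let T > 0, 0 < σ ≤ T, and let Ỹᵃ : ℝ → ℝ^p and Ỹ : ℝ → ℝ^p be continuous functions (the attacked innovation and the healthy innovation). Suppose there are constants M ≥ 0, c ≥ 0, r ≥ 0 and a function β̌ : ℝ≥0 × ℝ≥0 → ℝ≥0 which is nonincreasing in its second argument, such that for all s ∈ [T, 2T): ‖Ỹᵃ(s)‖ + ‖Ỹ(s − T)‖ ≤ M and ‖Ỹᵃ(s) − Ỹ(s − T)‖ ≤ c·β̌(r, s). Then for every t ∈ [T + σ, 2T), the monitoring signal satisfies (1/σ) ∫_{t−σ}^{t} ‖Ỹᵃ(s)‖²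 ds ≤ (1/σ) ∫_{t−σ}^{t} ‖Ỹ(s − T)‖² ds + M·c·β̌(r, t − σ). -/
open MeasureTheory intervalIntegral

noncomputable section

theorem replay_attack_monitoring_signal_bound
    {p : ℕ} (T σ : ℝ) (hT : 0 < T) (hσ : 0 < σ) (hσT : σ ≤ T)
    (Ya Yh : ℝ → EucSp p) (hYa : Continuous Ya) (hYh : Continuous Yh)
    (M c r : ℝ) (hM : 0 ≤ M) (hc : 0 ≤ c) (hr : 0 ≤ r)
    (βcheck : ℝ → ℝ → ℝ)
    (hβnonneg : ∀ a b : ℝ, 0 ≤ a → 0 ≤ b → 0 ≤ βcheck a b)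
    (hβanti : ∀ a : ℝ, AntitoneOn (βcheck a) (Set.Ici (0 : ℝ)))
    (hbound : ∀ s : ℝ, T ≤ s → s < 2 * T →
      ‖Ya s‖ + ‖Yh (s - T)‖ ≤ M ∧ ‖Ya s - Yh (s - T)‖ ≤ c * βcheck r s) :
    ∀ t : ℝ, T + σ ≤ t → t < 2 * T →
      (1 / σ) * (∫ s in (t - σ)..t, ‖Ya s‖ ^ 2) ≤
        (1 / σ) * (∫ s in (t - σ)..t, ‖Yh (s - T)‖ ^ 2) + M * c * βcheck r (t - σ) := by
  intro t ht1 ht2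
  have hi1 : IntervalIntegrable (fun s => ‖Ya s‖ ^ 2) volume (t - σ) t :=
    Continuous.intervalIntegrable (by fun_prop) _ _
  have hi2 : IntervalIntegrable (fun s => ‖Yh (s - T)‖ ^ 2) volume (t - σ) t :=
    Continuous.intervalIntegrable (by fun_prop) _ _
  have hic : IntervalIntegrable (fun _ : ℝ => M * c * βcheck r (t - σ)) volume (t - σ) t :=
    Continuous.intervalIntegrable (by fun_prop) _ _
  have key : (∫ s in (t - σ)..t, ‖Ya s‖ ^ 2) ≤
      ∫ s in (t - σ)..t, (‖Yh (s - T)‖ ^ 2 + M * c * βcheck r (t - σ)) := by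
    apply intervalIntegral.integral_mono_on (by linarith) hi1 (hi2.add hic)
    intro s hs
    obtain ⟨hs1, hs2⟩ := hs
    obtain ⟨h1, h2⟩ := hbound s (by linarith) (by linarith)
    have h3 : βcheck r s ≤ βcheck r (t - σ) :=
      hβanti r (Set.mem_Ici.2 (by linarith)) (Set.mem_Ici.2 (by linarith)) hs1
    have h4 := norm_sub_norm_le (Ya s) (Yh (s - T))
    have h5 : ‖Ya s‖ - ‖Yh (s - T)‖ ≤ c * βcheck r (t - σ) :=
      h4.trans (h2.trans (mul_le_mul_of_nonneg_left h3 hc))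
    have h6 : 0 ≤ c * βcheck r (t - σ) := mul_nonneg hc (hβnonneg _ _ hr (by linarith))
    have h7 := mul_le_mul_of_nonneg_left h5
      (add_nonneg (norm_nonneg (Ya s)) (norm_nonneg (Yh (s - T))))
    have h8 := mul_le_mul_of_nonneg_right h1 h6
    nlinarith
  rw [intervalIntegral.integral_add hi2 hic, intervalIntegral.integral_const] at key
  have h := mul_le_mul_of_nonneg_left key (one_div_pos.2 hσ).le
  refine h.trans (le_of_eq ?_)
  rw [smul_eq_mul]
  field_simp
  ring
end
end

section
/- Lower bound on the monitoring signal under a replay attack (Theorem 1, attack part, with corrected constants): Let T > 0, 0 < σ ≤ T and t ∈ [T + σ, 2T). Let y : ℝ → ℝ^p (recorded plant output), ξ : ℝ → ℝ^m (watermark), ŷᵃ : ℝ → ℝ^p (attacked observer output) and ŷ : ℝ → ℝ^p (healthy observer output) be continuous, and define the attacked innovation Ỹᵃ(s) = y(s − T) − ŷᵃ(s) and the shifted healthy innovation Ỹ(s − T) = y(s − T) − ŷ(s − T). Suppose there are constants γ⁻ ≥ 0, g_n ≥ 0 and δ ≥ 0 such that: (i) incremental L2-minus gain bound: ∫_{t−σ}^{t}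 ‖ŷᵃ(s) − ŷ(s − T)‖² ds ≥ γ⁻ ∫_{t−σ}^{t} ‖ξ(s) − ξ(s − T)‖² ds − δ; and (ii) healthy detection bound: (1/σ) ∫_{t−σ}^{t} ‖Ỹ(s − T)‖² ds ≤ g_n. Then the monitoring signal under attack satisfies (1/σ) ∫_{t−σ}^{t} ‖Ỹᵃ(s)‖² ds ≥ (γ⁻/(2σ)) ∫_{t−σ}^{t} ‖ξ(s) − ξ(s − T)‖² ds − δ/(2σ) − g_n. -/
open MeasureTheory intervalIntegral

noncomputable section

theorem monitoring_signal_lower_bound_under_replay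
    {p m : ℕ} (T σ t : ℝ) (hT : 0 < T) (hσ : 0 < σ) (hσT : σ ≤ T)
    (ht₁ : T + σ ≤ t) (ht₂ : t < 2 * T)
    (y yhata yhat : ℝ → EucSp p) (ξ : ℝ → EucSp m)
    (hy : Continuous y) (hyhata : Continuous yhata)
    (hyhat : Continuous yhat) (hξ : Continuous ξ)
    (γminus gn δ : ℝ) (hγ : 0 ≤ γminus) (hgn : 0 ≤ gn) (hδ : 0 ≤ δ)
    -- (i) incremental L2-minus gain bound on the observer outputs
    (hgain : (∫ s in (t - σ)..t, ‖yhata s - yhat (s - T)‖ ^ 2) ≥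
      γminus * (∫ s in (t - σ)..t, ‖ξ s - ξ (s - T)‖ ^ 2) - δ)
    -- (ii) healthy detection bound
    (hhealthy : (1 / σ) * (∫ s in (t - σ)..t, ‖y (s - T) - yhat (s - T)‖ ^ 2) ≤ gn) :
    (1 / σ) * (∫ s in (t - σ)..t, ‖y (s - T) - yhata s‖ ^ 2) ≥
      (γminus / (2 * σ)) * (∫ s in (t - σ)..t, ‖ξ s - ξ (s - T)‖ ^ 2) -
        δ / (2 * σ) - gn := by
  have hA : Continuous fun s => ‖y (s - T) - yhata s‖ ^ 2 := by fun_prop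
  have hB : Continuous fun s => ‖y (s - T) - yhat (s - T)‖ ^ 2 := by fun_prop
  have hC : Continuous fun s => ‖yhata s - yhat (s - T)‖ ^ 2 := by fun_prop
  have key : (∫ s in (t - σ)..t, ‖yhata s - yhat (s - T)‖ ^ 2) ≤
      ∫ s in (t - σ)..t, (2 * ‖y (s - T) - yhata s‖ ^ 2 +
        2 * ‖y (s - T) - yhat (s - T)‖ ^ 2) := by
    apply intervalIntegral.integral_mono_on (by linarith) (hC.intervalIntegrable _ _)
      (((hA.const_mul 2).add (hB.const_mul 2)).intervalIntegrable _ _)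
    intro s _
    have h1 : ‖yhata s - yhat (s - T)‖ ≤
        ‖y (s - T) - yhata s‖ + ‖y (s - T) - yhat (s - T)‖ := by
      have h := norm_sub_le (y (s - T) - yhat (s - T)) (y (s - T) - yhata s)
      rw [sub_sub_sub_cancel_left] at h
      linarith
    change _ ≤ 2 * ‖y (s - T) - yhata s‖ ^ 2 + 2 * ‖y (s - T) - yhat (s - T)‖ ^ 2
    nlinarith [norm_nonneg (yhata s - yhat (s - T)),
      sq_nonneg (‖y (s - T) - yhata s‖ - ‖y (s - T) - yhat (s - T)‖)]
  rw [intervalIntegral.integral_add ((hA.const_mul 2).intervalIntegrable _ _)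
      ((hB.const_mul 2).intervalIntegrable _ _),
    intervalIntegral.integral_const_mul, intervalIntegral.integral_const_mul] at key
  generalize (∫ s in (t - σ)..t, ‖y (s - T) - yhata s‖ ^ 2) = A at *
  generalize (∫ s in (t - σ)..t, ‖y (s - T) - yhat (s - T)‖ ^ 2) = B at *
  generalize (∫ s in (t - σ)..t, ‖yhata s - yhat (s - T)‖ ^ 2) = C at *
  generalize (∫ s in (t - σ)..t, ‖ξ s - ξ (s - T)‖ ^ 2) = X at *
  have h2 : (1 / (2 * σ)) * (γminus * X - δ) ≤ (1 / (2 * σ)) * (2 * A + 2 * B) :=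
    mul_le_mul_of_nonneg_left (by linarith) (by positivity)
  have e1 : (1 / (2 * σ)) * (γminus * X - δ) = γminus / (2 * σ) * X - δ / (2 * σ) := by ring
  have e2 : (1 / (2 * σ)) * (2 * A + 2 * B) = 1 / σ * A + 1 / σ * B := by
    field_simp
  linarith
end
end

section
/- Equivalence of the observer-gain condition and its iterative-LMI form (Proposition 9, zero-margin form): Let A : ℝ^n → ℝ^{n×n} be any matrix-valued function (A(x) is the Jacobian of the plant drift at x), and fix C ∈ ℝ^{p×n}. For symmetric positive definite R ∈ ℝ^{n×n} and L ∈ ℝ^{n×p}, say condition (I) holds if for every x ∈ ℝ^n: A(x)ᵀR + R·A(x) − CᵀLᵀR − RLC ⪯ 0. For symmetric positive definite R₀, R ∈ ℝ^{n×n} and L₀, L ∈ ℝ^{n×p}, say condition (II) holds if for every x ∈ ℝ^n the symmetric 2×2 block matrix with blocks (1,1) = A(x)ᵀR + R·A(x) − R₀R − RR₀ + R₀R₀ − (L₀C)ᵀLC − (LC)ᵀL₀C + (L₀C)ᵀL₀C, (1,2) = R − (LC)ᵀ, (2,2) = −I_n is negative semidefinite. Then there exist a symmetric positive definite R and a matrix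 L such that (I) holds if and only if there exist symmetric positive definite R₀, R and matrices L₀, L such that (II) holds. -/
open Matrix

noncomputable section

theorem schur_aux {n : ℕ} (X B : Matrix (Fin n) (Fin n) ℝ) :
    (-(Matrix.fromBlocks X B Bᵀ (-(1 : Matrix (Fin n) (Fin n) ℝ)))).PosSemidef ↔
      (-(X + B * Bᵀ)).PosSemidef := by
  haveI : Invertible (1 : Matrix (Fin n) (Fin n) ℝ) := invertibleOne
  have h := PosDef.fromBlocks₂₂ (-X) (-B) (PosDef.one (n := Fin n) (R := ℝ))
  have e1 : -(Matrix.fromBlocks X B Bᵀ (-(1 : Matrix (Fin n) (Fin n) ℝ))) =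
      Matrix.fromBlocks (-X) (-B) (-B)ᴴ 1 := by
    rw [Matrix.fromBlocks_neg, neg_neg, conjTranspose_neg, conjTranspose_eq_transpose_of_trivial]
  have e2 : -(X + B * Bᵀ) = -X - -B * (1 : Matrix (Fin n) (Fin n) ℝ)⁻¹ * (-B)ᴴ := by
    rw [conjTranspose_neg, conjTranspose_eq_transpose_of_trivial, inv_one]
    noncomm_ring
  rw [e1, e2]
  exact h

theorem alg_aux {n : ℕ} (Q R R₀ M M₀ : Matrix (Fin n) (Fin n) ℝ) (hR : Rᵀ = R) :
    (Q - R₀ * R - R * R₀ + R₀ * R₀ - M₀ᵀ * M - Mᵀ * M₀ + M₀ᵀ * M₀) + (R - Mᵀ) * (R - Mᵀ)ᵀ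
      = (Q - Mᵀ * R - R * M) + ((R - R₀) * (R - R₀) + (M - M₀)ᵀ * (M - M₀)) := by
  simp only [transpose_sub, transpose_transpose, hR]
  noncomm_ring

theorem observer_gain_iff_iterative_LMI
    {n p : ℕ}
    (A : EucSp n → Matrix (Fin n) (Fin n) ℝ)
    (C : Matrix (Fin p) (Fin n) ℝ) :
    (∃ R : Matrix (Fin n) (Fin n) ℝ, R.PosDef ∧
      ∃ L : Matrix (Fin n) (Fin p) ℝ,
        ∀ x : EucSp n,
          (-((A x)ᵀ * R + R * A x - Cᵀ * Lᵀ * R - R * (L * C))).PosSemidef) ↔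
    (∃ R₀ R : Matrix (Fin n) (Fin n) ℝ, R₀.PosDef ∧ R.PosDef ∧
      ∃ L₀ L : Matrix (Fin n) (Fin p) ℝ,
        ∀ x : EucSp n,
          (-(Matrix.fromBlocks
            ((A x)ᵀ * R + R * A x - R₀ * R - R * R₀ + R₀ * R₀ -
              (L₀ * C)ᵀ * (L * C) - (L * C)ᵀ * (L₀ * C) + (L₀ * C)ᵀ * (L₀ * C))
            (R - (L * C)ᵀ)
            ((R - (L * C)ᵀ)ᵀ)
            (-(1 : Matrix (Fin n) (Fin n) ℝ)))).PosSemidef) := by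
  constructor
  · rintro ⟨R, hR, L, h⟩
    have hT : Rᵀ = R := by
      rw [← conjTranspose_eq_transpose_of_trivial]; exact hR.isHermitian
    refine ⟨R, R, hR, hR, L, L, fun x => ?_⟩
    rw [schur_aux, alg_aux _ _ _ _ _ hT]
    simpa [transpose_mul] using h x
  · rintro ⟨R₀, R, hR₀, hR, L₀, L, h⟩
    have hT : Rᵀ = R := by
      rw [← conjTranspose_eq_transpose_of_trivial]; exact hR.isHermitian
    have hD : (R - R₀)ᴴ = R - R₀ := (hR.isHermitian.sub hR₀.isHermitian)
    refine ⟨R, hR, L, fun x => ?_⟩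
    have hx := h x
    rw [schur_aux, alg_aux _ _ _ _ _ hT] at hx
    have p1 : ((R - R₀) * (R - R₀)).PosSemidef := by
      have := posSemidef_conjTranspose_mul_self (R - R₀)
      rwa [hD] at this
    have p2 : ((L * C - L₀ * C)ᵀ * (L * C - L₀ * C)).PosSemidef := by
      have := posSemidef_conjTranspose_mul_self (L * C - L₀ * C)
      rwa [conjTranspose_eq_transpose_of_trivial] at this
    have := hx.add (p1.add p2)
    rw [neg_add, neg_add_cancel_right, transpose_mul] at this
    exact this
end
end
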